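/- Let (A_i, φ_{i,j}) be an inductive system of C₀(X)-algebras with C₀(X)-linear connecting maps and A = lim A_i its limit C₀(X)-algebra. Then for every x ∈ X, the fibres ((A_i)_x, (φ_{i,j})_x) form an inductive system of C*-algebras and there is a canonical isomorphism lim_i (A_i)_x ≅ A_x; moreover the kernel of the induced map A → lim_i (A_i)_x equals the ideal I_x = closure of C₀(X∖{x})·A. -/

import Mathlib

/-!
Statement 1: for an inductive system of C₀(X)-algebras, the fibres form an inductive
system and `lim (A i)ₓ ≅ (lim A i)ₓ`; the kernel of the induced map `A → lim (A i)ₓ`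
is the ideal `Iₓ = closure (C₀(X∖{x})·A)`.
-/

noncomputable section
open ZeroAtInfty MultiplierAlgebra Function

/-- A `C₀(X)`-algebra structure on a C*-algebra `A`. -/
structure C0Structure (X : Type) [TopologicalSpace X] (A : Type)
    [NonUnitalCStarAlgebra A] where
  Φ : C₀(X, ℂ) →⋆ₙₐ[ℂ] 𝓜(ℂ, A)
  central : ∀ f, Φ f ∈ Set.center 𝓜(ℂ, A)
  nondegenerate :
    (Submodule.span ℂ {x : A | ∃ (f : C₀(X, ℂ)) (a : A), x = (Φ f).fst a}).topologicalClosure = ⊤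

/-- The action of `C₀(X)` on `A`. -/
def C0Structure.smul {X : Type} [TopologicalSpace X] {A : Type} [NonUnitalCStarAlgebra A]
    (S : C0Structure X A) (f : C₀(X, ℂ)) (a : A) : A :=
  (S.Φ f).fst a

/-- `C₀(X)`-linearity of a `*`-homomorphism between `C₀(X)`-algebras. -/
def IsC0Linear {X : Type} [TopologicalSpace X] {A B : Type}
    [NonUnitalCStarAlgebra A] [NonUnitalCStarAlgebra B]
    (SA : C0Structure X A) (SB : C0Structure X B) (ψ : A →⋆ₙₐ[ℂ] B) : Prop :=
  ∀ (f : C₀(X, ℂ)) (a : A), ψ (SA.smul f a) = SB.smul f (ψ a)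

/-- The ideal `Iₓ = closure (C₀(X∖{x})·A)` of a `C₀(X)`-algebra at a point `x ∈ X`. -/
def fiberIdeal {X : Type} [TopologicalSpace X] {A : Type} [NonUnitalCStarAlgebra A]
    (S : C0Structure X A) (x : X) : Set A :=
  closure (Submodule.span ℂ
    {y : A | ∃ (f : C₀(X, ℂ)) (a : A), f x = 0 ∧ y = S.smul f a} : Set A)

/-- Data exhibiting `F` (with quotient map `π`) as the fibre `Aₓ = A/Iₓ` of the
`C₀(X)`-algebra `A` at `x`. -/
structure FibreData {X : Type} [TopologicalSpace X] {A : Type} [NonUnitalCStarAlgebra A]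
    (S : C0Structure X A) (x : X) (F : Type) [NonUnitalCStarAlgebra F] where
  π : A →⋆ₙₐ[ℂ] F
  surjective : Function.Surjective π
  ker_eq : {a : A | π a = 0} = fiberIdeal S x

/-- Inductive system of C*-algebras. -/
def IsInductiveSystem {I : Type} [Preorder I] {A : I → Type}
    [∀ i, NonUnitalCStarAlgebra (A i)]
    (φ : ∀ {i j : I}, i ≤ j → (A i →⋆ₙₐ[ℂ] A j)) : Prop :=
  (∀ (i : I) (h : i ≤ i) (a : A i), φ h a = a) ∧
  ∀ {i j k : I} (hij : i ≤ j) (hjk : j ≤ k) (a : A i), φ hjk (φ hij a) = φ (hij.trans hjk) a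

/-- `(L, ψ)` is the inductive limit of the system `(A i, φ)` of C*-algebras. -/
def IsCStarLimit {I : Type} [Preorder I] {A : I → Type}
    [∀ i, NonUnitalCStarAlgebra (A i)]
    (φ : ∀ {i j : I}, i ≤ j → (A i →⋆ₙₐ[ℂ] A j)) (L : Type) [NonUnitalCStarAlgebra L]
    (ψ : ∀ i, A i →⋆ₙₐ[ℂ] L) : Prop :=
  (∀ {i j : I} (h : i ≤ j) (a : A i), ψ j (φ h a) = ψ i a) ∧
  Dense (⋃ i, Set.range (ψ i)) ∧
  ∀ (i : I) (a : A i), ‖ψ i a‖ = ⨅ j : {j : I // i ≤ j}, ‖φ j.2 a‖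

/-- The norm on the image of a `*`-homomorphism is the quotient norm: an element whose image has
norm at most `ε` is within `ε` of the kernel. -/
theorem exists_ker_near {A B : Type} [NonUnitalCStarAlgebra A] [NonUnitalCStarAlgebra B]
    (π : A →⋆ₙₐ[ℂ] B) (b : A) (ε : ℝ) (hε : 0 < ε) (hb : ‖π b‖ ≤ ε) :
    ∃ c : A, π c = 0 ∧ ‖b - c‖ ≤ ε := by
  set g : ℝ → ℝ := fun t => 1 - ε / Real.sqrt (max |t| (ε ^ 2)) with hg
  have hpos : ∀ t : ℝ, 0 < Real.sqrt (max |t| (ε ^ 2)) := fun t =>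
    Real.sqrt_pos.2 (lt_of_lt_of_le (by positivity) (le_max_right _ _))
  have hgc : Continuous g := by
    refine continuous_const.sub (continuous_const.div (by fun_prop) fun t => (hpos t).ne')
  have hgz : ∀ t, |t| ≤ ε ^ 2 → g t = 0 := by
    intro t ht
    simp only [hg]
    rw [max_eq_right ht, Real.sqrt_sq hε.le, div_self hε.ne', sub_self]
  have hg0 : g 0 = 0 := hgz 0 (by simp; positivity)
  have hh : IsSelfAdjoint (star b * b) := IsSelfAdjoint.star_mul_self b
  have hh' : IsSelfAdjoint (π (star b * b)) := hh.map π
  set u : A := cfcₙ g (star b * b) with hu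
  have husa : star u = u := (IsSelfAdjoint.cfcₙ (f := g) (a := star b * b)).star_eq
  have hcont : Continuous π :=
    AddMonoidHomClass.continuous_of_bound π 1 fun a => by
      simpa using NonUnitalStarAlgHom.norm_apply_le π a
  refine ⟨b * u, ?_, ?_⟩
  · have h1 : π u = 0 := by
      rw [hu, NonUnitalStarAlgHom.map_cfcₙ π g (star b * b) hgc.continuousOn hg0 hcont hh hh']
      rw [cfcₙ_congr (g := fun _ => (0 : ℝ)), cfcₙ_const_zero]
      intro t ht
      refine hgz t ?_
      have := NonUnitalIsometricContinuousFunctionalCalculus.norm_quasispectrum_le _ ht hh'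
      rw [map_mul, map_star, CStarRing.norm_star_mul_self, Real.norm_eq_abs] at this
      nlinarith [norm_nonneg (π b)]
    rw [map_mul, h1, mul_zero]
  · have key : star (b - b * u) * (b - b * u) =
        cfcₙ (fun t => (t - t * g t) - (g t * t - g t * (t * g t))) (star b * b) := by
      have hc : ∀ s, ContinuousOn g s := fun s => hgc.continuousOn
      rw [cfcₙ_sub (fun t => t - t * g t) (fun t => g t * t - g t * (t * g t)) (star b * b)
          (by fun_prop) (by simp [hg0]) (by fun_prop) (by simp [hg0]),
        cfcₙ_sub (fun t => t) (fun t => t * g t) (star b * b)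
          (by fun_prop) (by simp [hg0]) (by fun_prop) (by simp [hg0]),
        cfcₙ_sub (fun t => g t * t) (fun t => g t * (t * g t)) (star b * b)
          (by fun_prop) (by simp [hg0]) (by fun_prop) (by simp [hg0]),
        cfcₙ_mul g (fun t => t * g t) (star b * b)
          (by fun_prop) (by simp [hg0]) (by fun_prop) (by simp [hg0]),
        cfcₙ_mul g (fun t => t) (star b * b)
          (by fun_prop) (by simp [hg0]) (by fun_prop) (by simp [hg0]),
        cfcₙ_mul (fun t => t) g (star b * b)
          (by fun_prop) (by simp [hg0]) (by fun_prop) (by simp [hg0]),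
        cfcₙ_id' ℝ (star b * b) hh, ← hu, star_sub, star_mul, husa]
      simp only [sub_mul, mul_sub, mul_assoc]
      abel
    have hn : ‖star (b - b * u) * (b - b * u)‖ ≤ ε ^ 2 := by
      rw [key]
      refine norm_cfcₙ_le fun t _ => ?_
      have e1 : (t - t * g t) - (g t * t - g t * (t * g t)) = t * (1 - g t) ^ 2 := by ring
      have e2 : (1 - g t) ^ 2 = ε ^ 2 / max |t| (ε ^ 2) := by
        simp only [hg, sub_sub_cancel, div_pow]
        rw [Real.sq_sqrt (le_trans (abs_nonneg t) (le_max_left _ _))]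
      have hm : 0 < max |t| (ε ^ 2) := lt_of_lt_of_le (by positivity) (le_max_right _ _)
      rw [e1, e2, Real.norm_eq_abs, abs_mul, abs_of_nonneg (by positivity : 0 ≤ ε ^ 2 / max |t| (ε ^ 2)),
        ← mul_div_assoc, div_le_iff₀ hm, mul_comm]
      exact mul_le_mul_of_nonneg_left (le_max_left _ _) (by positivity)
    rw [CStarRing.norm_star_mul_self] at hn
    nlinarith [norm_nonneg (b - b * u)]

/-- A `C₀(X)`-linear `*`-homomorphism maps fibre ideals to fibre ideals. -/
theorem map_fiberIdeal {X : Type} [TopologicalSpace X] {A B : Type}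
    [NonUnitalCStarAlgebra A] [NonUnitalCStarAlgebra B]
    (SA : C0Structure X A) (SB : C0Structure X B) (ψ : A →⋆ₙₐ[ℂ] B) (h : IsC0Linear SA SB ψ)
    (x : X) (c : A) (hc : c ∈ fiberIdeal SA x) : ψ c ∈ fiberIdeal SB x := by
  have hcont : Continuous ψ :=
    AddMonoidHomClass.continuous_of_bound ψ 1 fun a => by
      simpa using NonUnitalStarAlgHom.norm_apply_le ψ a
  refine map_mem_closure hcont hc ?_
  intro y hy
  refine Submodule.span_induction (p := fun y _ => ψ y ∈ (Submodule.span ℂ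
    {y : B | ∃ (f : C₀(X, ℂ)) (a : B), f x = 0 ∧ y = SB.smul f a} : Set B)) ?_ ?_ ?_ ?_ hy
  · rintro _ ⟨f, a, hf, rfl⟩
    exact Submodule.subset_span ⟨f, ψ a, hf, h f a⟩
  · simp
  · intro y z _ _ hy hz
    rw [map_add]
    exact Submodule.add_mem _ hy hz
  · intro r y _ hy
    rw [map_smul]
    exact Submodule.smul_mem _ r hy

/-- Two `*`-homomorphisms with the same kernel, the first surjective and the second with dense
range, have canonically isomorphic targets. -/
theorem exists_starAlgEquiv {L F M : Type} [NonUnitalCStarAlgebra L] [NonUnitalCStarAlgebra F]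
    [NonUnitalCStarAlgebra M] (p : L →⋆ₙₐ[ℂ] F) (q : L →⋆ₙₐ[ℂ] M)
    (hp : Function.Surjective p) (hq : DenseRange q) (hker : ∀ a, p a = 0 ↔ q a = 0) :
    ∃ e : F ≃⋆ₐ[ℂ] M, ∀ a, e (p a) = q a := by
  have hwd : ∀ a b, p a = p b → q a = q b := by
    intro a b hab
    rw [← sub_eq_zero, ← map_sub, ← hker, map_sub, hab, sub_self]
  set s : F → L := Function.surjInv hp with hs
  have hps : ∀ y, p (s y) = y := Function.surjInv_eq hp
  let e0 : F →⋆ₙₐ[ℂ] M :=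
    { toFun := fun y => q (s y)
      map_smul' := fun r y => by
        simp only [MonoidHom.id_apply]
        rw [← map_smul]
        exact hwd _ _ (by rw [map_smul, hps, hps])
      map_zero' := by rw [← hker, hps]
      map_add' := fun y z => by
        rw [← map_add]
        exact hwd _ _ (by rw [map_add, hps, hps, hps])
      map_mul' := fun y z => by
        rw [← map_mul]
        exact hwd _ _ (by rw [map_mul, hps, hps, hps])
      map_star' := fun y => by
        rw [← map_star]
        exact hwd _ _ (by rw [map_star, hps, hps]) }
  have he0 : ∀ a, e0 (p a) = q a := fun a => hwd _ _ (hps _)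
  have hinj : Function.Injective e0 := by
    refine (injective_iff_map_eq_zero e0).2 fun y hy => ?_
    have : q (s y) = 0 := hy
    rw [← hker, hps] at this
    exact this
  have hiso : Isometry e0 := NonUnitalStarAlgHom.isometry e0 hinj
  have hsurj : Function.Surjective e0 := by
    rw [← Set.range_eq_univ, ← hiso.isClosedEmbedding.isClosed_range.closure_eq]
    refine Dense.closure_eq (hq.mono ?_)
    rintro _ ⟨a, rfl⟩
    exact ⟨p a, he0 a⟩
  exact ⟨StarAlgEquiv.ofBijective e0 ⟨hinj, hsurj⟩, he0⟩

/-- Let `(A i, φ)` be an inductive system of `C₀(X)`-algebras with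
`C₀(X)`-linear connecting maps, with inductive limit `(L, ψ)`, and let `x ∈ X`.
Let `F i` be the fibre of `A i` at `x` (with quotient maps `(πF i).π`), let
`φx` be the maps induced on the fibres by the connecting maps, let `Fx` be the fibre of `L`
at `x`, let `(Lx, ψx)` be an inductive limit of the system of fibres, and let
`π' : L → Lx` be the map induced on the limits.  Then the fibres form an inductive system,
the kernel of `π'` equals the ideal `Iₓ` of `L`, and consequently there is a canonical
isomorphism `lim (A i)ₓ ≅ Lₓ` compatible with the quotient maps. -/
theorem fibres_of_inductiveLimit
    (X : Type) [TopologicalSpace X] [LocallyCompactSpace X] [T2Space X]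
    (I : Type) [Preorder I] [IsDirected I (· ≤ ·)] [Nonempty I]
    (A : I → Type) [∀ i, NonUnitalCStarAlgebra (A i)]
    (φ : ∀ {i j : I}, i ≤ j → (A i →⋆ₙₐ[ℂ] A j)) (hφ : IsInductiveSystem φ)
    (S : ∀ i, C0Structure X (A i))
    (hlin : ∀ {i j : I} (h : i ≤ j), IsC0Linear (S i) (S j) (φ h))
    (L : Type) [NonUnitalCStarAlgebra L]
    (ψ : ∀ i, A i →⋆ₙₐ[ℂ] L) (hL : IsCStarLimit φ L ψ)
    (SL : C0Structure X L) (hSL : ∀ i, IsC0Linear (S i) SL (ψ i))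
    (x : X)
    -- the fibres of the `A i` at `x`
    (F : I → Type) [∀ i, NonUnitalCStarAlgebra (F i)]
    (πF : ∀ i, FibreData (S i) x (F i))
    -- the maps induced on the fibres by the connecting maps
    (φx : ∀ {i j : I}, i ≤ j → (F i →⋆ₙₐ[ℂ] F j))
    (hφx : ∀ {i j : I} (h : i ≤ j) (a : A i), φx h ((πF i).π a) = (πF j).π (φ h a))
    -- the fibre of `L` at `x`
    (Fx : Type) [NonUnitalCStarAlgebra Fx] (πL : FibreData SL x Fx)
    -- an inductive limit of the system of fibres
    (Lx : Type) [NonUnitalCStarAlgebra Lx]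
    (ψx : ∀ i, F i →⋆ₙₐ[ℂ] Lx) (hLx : IsCStarLimit (fun h => φx h) Lx ψx)
    -- the map induced by the universal property on the limits
    (π' : L →⋆ₙₐ[ℂ] Lx)
    (hπ' : ∀ (i : I) (a : A i), π' (ψ i a) = ψx i ((πF i).π a)) :
    -- the fibres form an inductive system of C*-algebras,
    IsInductiveSystem (fun h => φx h) ∧
    -- the kernel of the induced map `L → lim (A i)ₓ` is the ideal `Iₓ`,
    {a : L | π' a = 0} = fiberIdeal SL x ∧
    -- and hence there is a canonical isomorphism `Lₓ ≅ lim (A i)ₓ`.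
    ∃ e : Fx ≃⋆ₐ[ℂ] Lx, ∀ a : L, e (πL.π a) = π' a := by
  have hcont : Continuous π' :=
    AddMonoidHomClass.continuous_of_bound π' 1 fun a => by
      simpa using NonUnitalStarAlgHom.norm_apply_le π' a
  have hker : {a : L | π' a = 0} = fiberIdeal SL x := by
    apply Set.Subset.antisymm
    · intro a ha
      change π' a = 0 at ha
      have hcl : IsClosed (fiberIdeal SL x) := isClosed_closure
      rw [← hcl.closure_eq, Metric.mem_closure_iff]
      intro ε hε
      have hε2 : 0 < ε / 2 := by positivity
      obtain ⟨_, hmem, hdist⟩ := Metric.mem_closure_iff.1 (hL.2.1 a) (ε / 2) hε2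
      obtain ⟨i, b, rfl⟩ := Set.mem_iUnion.1 hmem
      have h1 : ‖ψx i ((πF i).π b)‖ < ε / 2 := by
        rw [← hπ', ← sub_zero (π' (ψ i b)), ← ha, ← map_sub]
        refine lt_of_le_of_lt (NonUnitalStarAlgHom.norm_apply_le π' _) ?_
        rwa [← dist_eq_norm, dist_comm]
      rw [hLx.2.2 i ((πF i).π b)] at h1
      haveI : Nonempty {j : I // i ≤ j} := ⟨⟨i, le_rfl⟩⟩
      obtain ⟨⟨j, hij⟩, hj⟩ := exists_lt_of_ciInf_lt h1
      change ‖φx hij ((πF i).π b)‖ < ε / 2 at hj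
      rw [hφx] at hj
      obtain ⟨c, hc0, hc⟩ := exists_ker_near (πF j).π (φ hij b) (ε / 2) hε2 hj.le
      have hc' : c ∈ fiberIdeal (S j) x := by
        rw [← (πF j).ker_eq]
        exact hc0
      refine ⟨ψ j c, map_fiberIdeal (S j) SL (ψ j) (hSL j) x c hc', ?_⟩
      have h2 : dist (ψ i b) (ψ j c) ≤ ε / 2 := by
        rw [← hL.1 hij b, dist_eq_norm, ← map_sub]
        exact (NonUnitalStarAlgHom.norm_apply_le (ψ j) _).trans hc
      linarith [dist_triangle a (ψ i b) (ψ j c)]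
    · refine closure_minimal ?_ (isClosed_eq hcont continuous_const)
      intro y hy
      refine Submodule.span_induction (p := fun y _ => π' y = 0) ?_ ?_ ?_ ?_ hy
      · rintro _ ⟨f, a, hf, rfl⟩
        have hcf : Continuous fun a : L => π' (SL.smul f a) :=
          hcont.comp (SL.Φ f).fst.continuous
        have hclosed : IsClosed {a : L | π' (SL.smul f a) = 0} :=
          isClosed_eq hcf continuous_const
        refine closure_minimal ?_ hclosed (hL.2.1 a)
        intro a ha
        obtain ⟨i, b, rfl⟩ := Set.mem_iUnion.1 ha
        change π' (SL.smul f (ψ i b)) = 0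
        have hz : (S i).smul f b ∈ {a : A i | (πF i).π a = 0} := by
          rw [(πF i).ker_eq]
          exact subset_closure (Submodule.subset_span ⟨f, b, hf, rfl⟩)
        have hz' : (πF i).π ((S i).smul f b) = 0 := hz
        rw [← hSL i f b, hπ', hz', map_zero]
      · exact map_zero π'
      · intro y z _ _ hy hz
        rw [map_add, hy, hz, add_zero]
      · intro r y _ hy
        rw [map_smul, hy, smul_zero]
  refine ⟨⟨?_, ?_⟩, hker, ?_⟩
  · intro i h a
    obtain ⟨a, rfl⟩ := (πF i).surjective a
    change φx h ((πF i).π a) = (πF i).π a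
    rw [hφx, hφ.1]
  · intro i j k hij hjk a
    obtain ⟨a, rfl⟩ := (πF i).surjective a
    change φx hjk (φx hij ((πF i).π a)) = φx (hij.trans hjk) ((πF i).π a)
    rw [hφx, hφx, hφx, hφ.2]
  · refine exists_starAlgEquiv πL.π π' πL.surjective ?_ ?_
    · refine Dense.mono ?_ hLx.2.1
      intro y hy
      obtain ⟨i, z, rfl⟩ := Set.mem_iUnion.1 hy
      obtain ⟨a, rfl⟩ := (πF i).surjective z
      exact ⟨ψ i a, hπ' i a⟩
    · intro a
      have : a ∈ {a : L | πL.π a = 0} ↔ a ∈ {a : L | π' a = 0} := by rw [πL.ker_eq, hker]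
      exact this

end
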